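/- arXiv:2106.00836 — 3 statements merged into one kernel-verified Lean document; each statement's English description precedes it below -/
import Mathlib

section
/- For every δ ∈ (0, 1/2] there exist constants C > 0, T₀ ≥ 2 and r₀ ∈ (0, 3/4), depending only on h and δ, such that for all T ≥ T₀ and y > 0 satisfying T − 1/4 > y, T·y ≤ r₀, and max( T⁴·(Ty/2)^{1/2}, T^{−1/6} )·(Ty/2)^{−δ} ≤ 1, and for every η̃ ∈ (0, 1/4]: | T·∫₀¹ Φ_{f_T}(x+iy,0) dx − (3/(2π²))·∫₀^{2π}∫₀¹ h(x,θ) dx dθ | ≤ C·( T⁴·η̃^{−4}·( (Ty/2)^{1/2}·(log(2/(Ty)))² + (Ty/2)^{1/2} ) + (Ty/2)^{δ} + T^{−1/2} + η̃/T ). -/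
open MeasureTheory

/-- `e(w) := exp(2πiw)`. -/
noncomputable def e (w : ℂ) : ℂ := Complex.exp (2 * Real.pi * Complex.I * w)

/-- Automorphic lift over `PSL(2,ℤ)` at the cusp `∞`; `a c d`, `b c d` are a choice of
integers with `a·d − b·c = 1` for coprime `(c,d)`, `c ≥ 1`. -/
noncomputable def lift (a b : ℕ → ℤ → ℤ) (f : ℂ → ℝ → ℂ) (z : ℂ) (θ : ℝ) : ℂ :=
  f z θ + ∑' c : ℕ, ∑' d : ℤ,
    if 1 ≤ c ∧ Int.gcd (c : ℤ) d = 1 then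
      f (((a c d : ℂ) * z + (b c d : ℂ)) / ((c : ℂ) * z + (d : ℂ)))
        (θ - 2 * Complex.arg ((c : ℂ) * z + (d : ℂ)))
    else 0

/-- `f_T(z,θ) := 1_{[T,∞)}(Im z) · h(Re z, θ)`. -/
noncomputable def fT (T : ℝ) (h : ℝ → ℝ → ℂ) (z : ℂ) (θ : ℝ) : ℂ :=
  if T ≤ z.im then h z.re θ else 0

section TotientSums

open ArithmeticFunction Finset

lemma sum_Ioc_inv_le_two_mul_sqrt (N : ℕ) :
    ∑ d ∈ Ioc 0 N, (d : ℝ)⁻¹ ≤ 2 * √N := by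
  induction N with
  | zero => simp
  | succ n ih =>
    rw [Finset.sum_Ioc_succ_top (Nat.zero_le n)]
    have hs0 : 0 ≤ √(n : ℝ) := Real.sqrt_nonneg _
    have hsq : √(n : ℝ) ^ 2 = n := Real.sq_sqrt (Nat.cast_nonneg n)
    have hr1 : 1 ≤ √((n + 1 : ℕ) : ℝ) :=
      Real.one_le_sqrt.2 (by push_cast; linarith [(Nat.cast_nonneg n : (0 : ℝ) ≤ n)])
    have hrq : √((n + 1 : ℕ) : ℝ) ^ 2 = n + 1 := by
      rw [Real.sq_sqrt (Nat.cast_nonneg _)]; push_cast; ring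
    have hsr : √(n : ℝ) ≤ √((n + 1 : ℕ) : ℝ) := Real.sqrt_le_sqrt (by push_cast; linarith)
    generalize √((n + 1 : ℕ) : ℝ) = r at *
    generalize √(n : ℝ) = s at *
    have h : (((n + 1 : ℕ) : ℝ))⁻¹ ≤ 2 * (r - s) := by
      have e1 : (r - s) * (r + s) = 1 := by nlinarith
      have e2 : (((n + 1 : ℕ) : ℝ)) = r ^ 2 := by rw [hrq]; push_cast; ring
      rw [e2, inv_le_iff_one_le_mul₀ (by positivity)]
      have : r + s ≤ 2 * r ^ 2 := by nlinarith
      nlinarith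
    linarith

lemma sum_Ioc_floor_div_le {Y : ℝ} (hY : 0 ≤ Y) :
    ∑ d ∈ Ioc 0 ⌊Y⌋₊, Y / d ≤ 2 * (Y * √Y) := by
  have h := sum_Ioc_inv_le_two_mul_sqrt ⌊Y⌋₊
  have h2 : √(⌊Y⌋₊ : ℝ) ≤ √Y := Real.sqrt_le_sqrt (Nat.floor_le hY)
  simp_rw [div_eq_mul_inv]
  rw [← Finset.mul_sum]
  nlinarith

lemma sum_card_divisors_le {Y : ℝ} (hY : 0 ≤ Y) :
    ∑ n ∈ Ioc 0 ⌊Y⌋₊, (n.divisors.card : ℝ) ≤ 2 * (Y * √Y) := by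
  have h := sum_Ioc_sigma0_eq_sum_div ⌊Y⌋₊
  simp only [sigma_zero_apply] at h
  have h' : ∑ n ∈ Ioc 0 ⌊Y⌋₊, (n.divisors.card : ℝ) = ∑ n ∈ Ioc 0 ⌊Y⌋₊, ((⌊Y⌋₊ / n : ℕ) : ℝ) := by
    exact_mod_cast h
  rw [h']
  refine le_trans (Finset.sum_le_sum fun d _ => ?_) (sum_Ioc_floor_div_le hY)
  refine Nat.cast_div_le.trans ?_
  gcongr
  exact Nat.floor_le hY

lemma abs_sum_Ioc_floor_sub_le {x : ℝ} (hx : 0 ≤ x) :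
    |∑ k ∈ Ioc 0 ⌊x⌋₊, (k : ℝ) - x ^ 2 / 2| ≤ x / 2 := by
  have hs : ∀ m : ℕ, ∑ k ∈ Ioc 0 m, (k : ℝ) = m * (m + 1) / 2 := by
    intro m
    induction m with
    | zero => simp
    | succ n ih =>
      rw [Finset.sum_Ioc_succ_top (Nat.zero_le n), ih]; push_cast; ring
  rw [hs]
  have h1 := Nat.floor_le hx
  have h2 := Nat.lt_floor_add_one x
  have h0 : (0 : ℝ) ≤ ⌊x⌋₊ := Nat.cast_nonneg _
  generalize (⌊x⌋₊ : ℝ) = m at *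
  rw [abs_le]
  constructor <;> nlinarith

lemma abs_intCast_moebius_le_one (n : ℕ) : |((moebius n : ℤ) : ℝ)| ≤ 1 := by
  exact_mod_cast (abs_moebius_le_one (n := n))

lemma hasSum_moebius_div_sq :
    HasSum (fun n : ℕ => ((moebius n : ℤ) : ℝ) / (n : ℝ) ^ 2) (6 / Real.pi ^ 2) := by
  have hs : (1 : ℝ) < (2 : ℂ).re := by norm_num
  have hsum : LSeriesSummable (fun n => ((moebius n : ℤ) : ℂ)) 2 :=
    LSeriesSummable_moebius_iff.2 hs
  have hval := LSeries_zeta_mul_Lseries_moebius hs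
  rw [LSeries_zeta_eq_riemannZeta hs, riemannZeta_two] at hval
  have h := hsum.LSeriesHasSum
  have hL : LSeries (fun n => ((moebius n : ℤ) : ℂ)) 2 = ((6 / Real.pi ^ 2 : ℝ) : ℂ) := by
    have hpi : (Real.pi : ℂ) ≠ 0 := by exact_mod_cast Real.pi_ne_zero
    push_cast
    field_simp at hval ⊢
    linear_combination hval
  rw [hL] at h
  unfold LSeriesHasSum at h
  rw [← Complex.hasSum_ofReal]
  convert h using 2 with n
  rcases eq_or_ne n 0 with rfl | hn
  · simp
  · rw [LSeries.term_of_ne_zero hn]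
    push_cast
    norm_cast

lemma abs_sum_moebius_div_sq_sub_le {N : ℕ} (hN : N ≠ 0) :
    |∑ d ∈ Ioc 0 N, ((moebius d : ℤ) : ℝ) / (d : ℝ) ^ 2 - 6 / Real.pi ^ 2| ≤ (N : ℝ)⁻¹ := by
  have ht := hasSum_moebius_div_sq.tendsto_sum_nat
  have ht2 := ((ht.comp (Filter.tendsto_add_atTop_nat 1)).const_sub
    (∑ d ∈ Ioc 0 N, ((moebius d : ℤ) : ℝ) / (d : ℝ) ^ 2)).abs
  refine le_of_tendsto ht2 ?_
  filter_upwards [Filter.eventually_ge_atTop N] with M hM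
  simp only [Function.comp]
  have e1 : ∑ d ∈ range (M + 1), ((moebius d : ℤ) : ℝ) / (d : ℝ) ^ 2
      = ∑ d ∈ Ioc 0 N, ((moebius d : ℤ) : ℝ) / (d : ℝ) ^ 2
        + ∑ d ∈ Ioc N M, ((moebius d : ℤ) : ℝ) / (d : ℝ) ^ 2 := by
    rw [Finset.sum_Ioc_consecutive _ (Nat.zero_le N) hM, Finset.sum_range_succ']
    simp only [Nat.cast_zero, ArithmeticFunction.map_zero, Int.cast_zero, zero_div, add_zero]
    refine (Finset.sum_bij (fun i _ => i + 1) ?_ ?_ ?_ ?_)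
    · intro a ha; simp at ha ⊢; omega
    · intro a _ b _ h; omega
    · intro b hb; simp at hb; exact ⟨b - 1, by simp; omega, by omega⟩
    · intro a _; rfl
  rw [e1, sub_add_cancel_left, abs_neg]
  refine (Finset.abs_sum_le_sum_abs _ _).trans ?_
  have := sum_Ioc_inv_sq_le_sub (α := ℝ) hN hM
  have h2 : ∑ d ∈ Ioc N M, |((moebius d : ℤ) : ℝ) / (d : ℝ) ^ 2| ≤
      ∑ d ∈ Ioc N M, ((d : ℝ) ^ 2)⁻¹ := by
    refine Finset.sum_le_sum fun d _ => ?_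
    rw [abs_div, div_eq_mul_inv, abs_of_nonneg (sq_nonneg (d : ℝ))]
    exact mul_le_of_le_one_left (by positivity) (abs_intCast_moebius_le_one d)
  have h3 : (0 : ℝ) ≤ (M : ℝ)⁻¹ := by positivity
  linarith

lemma sum_Ioc_totient (N : ℕ) :
    ∑ n ∈ Ioc 0 N, (n.totient : ℝ) =
      ∑ d ∈ Ioc 0 N, ((moebius d : ℤ) : ℝ) * ∑ k ∈ Ioc 0 (N / d), (k : ℝ) := by
  have h1 : ∀ n > 0, ∑ x ∈ n.divisorsAntidiagonal, ((moebius x.1 : ℤ) : ℝ) * (x.2 : ℝ)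
      = (n.totient : ℝ) := by
    refine (sum_eq_iff_sum_mul_moebius_eq (f := fun n => (n.totient : ℝ))
      (g := fun n => (n : ℝ))).1 ?_
    intro n _
    exact_mod_cast Nat.sum_totient n
  have h2 := sum_Ioc_mul_eq_sum_sum ((moebius : ArithmeticFunction ℤ) : ArithmeticFunction ℝ)
    ((ArithmeticFunction.id : ArithmeticFunction ℕ) : ArithmeticFunction ℝ) N
  simp only [intCoe_apply, natCoe_apply, id_apply] at h2
  rw [← h2]
  refine Finset.sum_congr rfl fun n hn => ?_
  rw [← h1 n (Finset.mem_Ioc.1 hn).1, mul_apply]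
  simp

/-- The summatory function of Euler's totient is `3/π² · Y² + O(Y^{3/2})`. -/
lemma abs_sum_totient_sub_le {Y : ℝ} (hY : 0 ≤ Y) :
    |∑ n ∈ Ioc 0 ⌊Y⌋₊, (n.totient : ℝ) - 3 / Real.pi ^ 2 * Y ^ 2| ≤ 2 * (Y * √Y) := by
  have hpi : 3 / Real.pi ^ 2 ≤ 1 := by
    rw [div_le_one (by positivity)]; nlinarith [Real.pi_gt_three]
  rcases lt_or_ge Y 1 with h1 | h1
  · rw [Nat.floor_eq_zero.2 h1]
    simp only [Ioc_self, sum_empty, zero_sub, abs_neg]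
    rw [abs_of_nonneg (by positivity)]
    have hs : Y ≤ √Y := Real.le_sqrt_of_sq_le (by nlinarith)
    have : Y ^ 2 ≤ Y * √Y := by nlinarith
    have h3 : 3 / Real.pi ^ 2 * Y ^ 2 ≤ 1 * Y ^ 2 := by gcongr
    have : 0 ≤ Y * √Y := by positivity
    linarith
  · set N := ⌊Y⌋₊ with hN
    have hN0 : N ≠ 0 := by rw [hN, Ne, Nat.floor_eq_zero]; linarith
    have hN1 : (1 : ℝ) ≤ N := by exact_mod_cast Nat.one_le_iff_ne_zero.2 hN0
    have hYN : Y < N + 1 := Nat.lt_floor_add_one Y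
    rw [sum_Ioc_totient]
    have hsplit : ∑ d ∈ Ioc 0 N, ((moebius d : ℤ) : ℝ) * ∑ k ∈ Ioc 0 (N / d), (k : ℝ)
          - 3 / Real.pi ^ 2 * Y ^ 2
        = ∑ d ∈ Ioc 0 N, ((moebius d : ℤ) : ℝ) *
            (∑ k ∈ Ioc 0 (N / d), (k : ℝ) - (Y / d) ^ 2 / 2)
          + Y ^ 2 / 2 * (∑ d ∈ Ioc 0 N, ((moebius d : ℤ) : ℝ) / (d : ℝ) ^ 2
              - 6 / Real.pi ^ 2) := by
      simp_rw [mul_sub, Finset.sum_sub_distrib, Finset.mul_sum]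
      have : ∀ d : ℕ, ((moebius d : ℤ) : ℝ) * ((Y / d) ^ 2 / 2)
          = Y ^ 2 / 2 * (((moebius d : ℤ) : ℝ) / (d : ℝ) ^ 2) := by intro d; ring
      simp_rw [this]
      ring
    rw [hsplit]
    have b1 : |∑ d ∈ Ioc 0 N, ((moebius d : ℤ) : ℝ) *
        (∑ k ∈ Ioc 0 (N / d), (k : ℝ) - (Y / d) ^ 2 / 2)| ≤ Y * √Y := by
      refine (Finset.abs_sum_le_sum_abs _ _).trans ?_
      have : ∑ d ∈ Ioc 0 N, |((moebius d : ℤ) : ℝ) *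
          (∑ k ∈ Ioc 0 (N / d), (k : ℝ) - (Y / d) ^ 2 / 2)| ≤ ∑ d ∈ Ioc 0 N, (Y / d) / 2 := by
        refine Finset.sum_le_sum fun d _ => ?_
        rw [abs_mul, hN, ← Nat.floor_div_natCast]
        calc _ ≤ 1 * ((Y / d) / 2) := mul_le_mul (abs_intCast_moebius_le_one d)
              (abs_sum_Ioc_floor_sub_le (by positivity)) (abs_nonneg _) zero_le_one
          _ = _ := one_mul _
      rw [← Finset.sum_div] at this
      have := sum_Ioc_floor_div_le hY
      rw [← hN] at this
      linarith
    have b2 : |Y ^ 2 / 2 * (∑ d ∈ Ioc 0 N, ((moebius d : ℤ) : ℝ) / (d : ℝ) ^ 2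
              - 6 / Real.pi ^ 2)| ≤ Y * √Y := by
      rw [abs_mul, abs_of_nonneg (by positivity : 0 ≤ Y ^ 2 / 2)]
      calc _ ≤ Y ^ 2 / 2 * (N : ℝ)⁻¹ := by
            gcongr; exact abs_sum_moebius_div_sq_sub_le hN0
        _ ≤ Y := by
            rw [← div_eq_mul_inv, div_le_iff₀ (by positivity)]; nlinarith
        _ ≤ Y * √Y := le_mul_of_one_le_right hY (Real.one_le_sqrt.2 h1)
    refine (abs_add_le _ _).trans ?_
    linarith

end TotientSums

section CoprimeRiemannSums

open ArithmeticFunction Finset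

lemma norm_sum_range_sub_integral_le {k : ℝ → ℂ} {L : ℝ} (hkc : Continuous k)
    (hk : ∀ x x', ‖k x - k x'‖ ≤ L * |x - x'|) {m : ℕ} (hm : m ≠ 0) :
    ‖∑ j ∈ range m, k ((j : ℝ) / m) - m * ∫ x in (0 : ℝ)..1, k x‖ ≤ L := by
  have hL : 0 ≤ L := by simpa using (norm_nonneg _).trans (hk 1 0)
  have hm0 : (0 : ℝ) < m := by exact_mod_cast Nat.pos_of_ne_zero hm
  have hsplit := intervalIntegral.sum_integral_adjacent_intervals (f := k) (μ := volume)
    (a := fun j : ℕ => (j : ℝ) / m) (n := m) (fun j _ => hkc.intervalIntegrable _ _)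
  simp only [Nat.cast_zero, zero_div, div_self hm0.ne'] at hsplit
  rw [← hsplit, Finset.mul_sum, ← Finset.sum_sub_distrib]
  have hb : ∀ j ∈ range m, ‖k ((j : ℝ) / m) -
      m * ∫ x in ((j : ℝ) / m)..(((j + 1 : ℕ) : ℝ) / m), k x‖ ≤ L / m := by
    intro j _
    have hlen : ((j + 1 : ℕ) : ℝ) / m - (j : ℝ) / m = 1 / m := by push_cast; ring
    have e1 : k ((j : ℝ) / m) - m * ∫ x in ((j : ℝ) / m)..(((j + 1 : ℕ) : ℝ) / m), k x
        = m * ∫ x in ((j : ℝ) / m)..(((j + 1 : ℕ) : ℝ) / m), (k ((j : ℝ) / m) - k x) := by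
      rw [intervalIntegral.integral_sub (by simp) (hkc.intervalIntegrable _ _),
        intervalIntegral.integral_const, hlen, mul_sub, Complex.real_smul]
      have : (m : ℂ) ≠ 0 := by exact_mod_cast hm
      push_cast
      field_simp
    rw [e1, norm_mul, Complex.norm_natCast]
    have := intervalIntegral.norm_integral_le_of_norm_le_const (a := (j : ℝ) / m)
      (b := ((j + 1 : ℕ) : ℝ) / m) (C := L * (1 / m)) (f := fun x => k ((j : ℝ) / m) - k x) ?_
    · rw [hlen, abs_of_pos (by positivity)] at this
      calc _ ≤ (m : ℝ) * (L * (1 / m) * (1 / m)) := by gcongr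
        _ = L / m := by field_simp
    · intro x hx
      have hle : (j : ℝ) / m ≤ ((j + 1 : ℕ) : ℝ) / m := by gcongr; simp
      rw [Set.uIoc_of_le hle] at hx
      refine (hk _ _).trans ?_
      gcongr
      rw [abs_le]
      constructor <;> linarith [hx.1, hx.2]
  refine (norm_sum_le_of_le _ hb).trans ?_
  rw [sum_const, card_range, nsmul_eq_mul]
  exact (mul_div_cancel₀ _ hm0.ne').le

lemma sum_coprime_range_eq (f : ℝ → ℂ) {c : ℕ} (hc : c ≠ 0) :
    ∑ j ∈ range c with j.Coprime c, f ((j : ℝ) / c) =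
      ∑ g ∈ c.divisors, ((moebius g : ℤ) : ℂ) * ∑ i ∈ range (c / g), f ((i : ℝ) / (c / g : ℕ)) := by
  have h1 : ∀ j : ℕ, (if j.Coprime c then f ((j : ℝ) / c) else 0)
      = ∑ g ∈ c.divisors, if g ∣ j then ((moebius g : ℤ) : ℂ) * f ((j : ℝ) / c) else 0 := by
    intro j
    have h2 : ∑ g ∈ (Nat.gcd j c).divisors, (moebius g : ℤ) = if Nat.gcd j c = 1 then 1 else 0 := by
      rw [← coe_mul_zeta_apply, moebius_mul_coe_zeta, one_apply]
    have h3 : (Nat.gcd j c).divisors = {g ∈ c.divisors | g ∣ j} := by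
      ext g
      simp only [Nat.mem_divisors, mem_filter, Nat.dvd_gcd_iff]
      have : Nat.gcd j c ≠ 0 := fun h => hc (Nat.gcd_eq_zero_iff.1 h).2
      tauto
    rw [← Finset.sum_filter, ← h3, ← Finset.sum_mul, ← Int.cast_sum, h2]
    simp only [Nat.coprime_iff_gcd_eq_one]
    split_ifs <;> simp
  rw [Finset.sum_filter, Finset.sum_congr rfl fun j _ => h1 j, Finset.sum_comm]
  refine Finset.sum_congr rfl fun g hg => ?_
  obtain ⟨m, rfl⟩ := Nat.dvd_of_mem_divisors hg
  have hg0 : 0 < g := Nat.pos_of_ne_zero (left_ne_zero_of_mul hc)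
  have hg0' : (g : ℝ) ≠ 0 := by exact_mod_cast hg0.ne'
  rw [Nat.mul_div_cancel_left _ hg0, ← Finset.sum_filter, Finset.mul_sum]
  symm
  refine Finset.sum_bij (fun i _ => g * i) ?_ ?_ ?_ ?_
  · intro i hi
    simp only [mem_filter, mem_range] at hi ⊢
    exact ⟨Nat.mul_lt_mul_of_pos_left hi hg0, dvd_mul_right _ _⟩
  · intro i _ j _ h
    exact Nat.eq_of_mul_eq_mul_left hg0 h
  · intro j hj
    simp only [mem_filter, mem_range] at hj
    obtain ⟨hj1, i, rfl⟩ := hj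
    exact ⟨i, mem_range.2 (Nat.lt_of_mul_lt_mul_left hj1), rfl⟩
  · intro i _
    congr 2
    push_cast
    rw [mul_div_mul_left _ _ hg0']

/-- Equidistribution of the reduced fractions `j/c` with error governed by the number of divisors
of `c`. -/
lemma norm_sum_coprime_sub_integral_le {k : ℝ → ℂ} {L : ℝ} (hkc : Continuous k)
    (hk : ∀ x x', ‖k x - k x'‖ ≤ L * |x - x'|) {c : ℕ} (hc : c ≠ 0) :
    ‖∑ j ∈ range c with j.Coprime c, k ((j : ℝ) / c) - c.totient * ∫ x in (0 : ℝ)..1, k x‖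
      ≤ L * c.divisors.card := by
  set I := ∫ x in (0 : ℝ)..1, k x with hI
  have hcard : (({j ∈ range c | j.Coprime c}).card : ℂ) = c.totient := by
    rw [Nat.totient_eq_card_coprime]
    simp_rw [Nat.coprime_comm]
  have e1 : ∑ j ∈ range c with j.Coprime c, k ((j : ℝ) / c) - c.totient * I
      = ∑ j ∈ range c with j.Coprime c, (fun x => k x - I) ((j : ℝ) / c) := by
    rw [Finset.sum_sub_distrib, sum_const, nsmul_eq_mul, hcard]
  rw [e1, sum_coprime_range_eq (fun x => k x - I) hc]
  have hb : ∀ g ∈ c.divisors, ‖((moebius g : ℤ) : ℂ) *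
      ∑ i ∈ range (c / g), (fun x => k x - I) ((i : ℝ) / (c / g : ℕ))‖ ≤ L := by
    intro g hg
    have hcg : c / g ≠ 0 := by
      have := Nat.div_pos (Nat.divisor_le hg) (Nat.pos_of_mem_divisors hg)
      omega
    have h2 := norm_sum_range_sub_integral_le hkc hk hcg
    have hmu : ‖((moebius g : ℤ) : ℂ)‖ ≤ 1 := by
      rw [Complex.norm_intCast]
      exact abs_intCast_moebius_le_one g
    rw [norm_mul, Finset.sum_sub_distrib, sum_const, card_range, nsmul_eq_mul]
    exact (mul_le_of_le_one_left (norm_nonneg _) hmu).trans h2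
  refine (norm_sum_le_of_le _ hb).trans ?_
  rw [sum_const, nsmul_eq_mul, mul_comm]

end CoprimeRiemannSums

section PeriodicFunctions

lemma exists_norm_le_of_periodic {E : Type*} [NormedAddCommGroup E] {g : ℝ × ℝ → E}
    (hg : Continuous g) {p q : ℝ} (hp : 0 < p) (hq : 0 < q)
    (h1 : ∀ x θ, g (x + p, θ) = g (x, θ)) (h2 : ∀ x θ, g (x, θ + q) = g (x, θ)) :
    ∃ M, 0 ≤ M ∧ ∀ z, ‖g z‖ ≤ M := by
  obtain ⟨M, hM⟩ := (isCompact_Icc (a := ((0 : ℝ), (0 : ℝ)))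
    (b := (p, q))).exists_bound_of_continuousOn hg.continuousOn
  have hb : ∀ z, ‖g z‖ ≤ M := by
    rintro ⟨x, θ⟩
    obtain ⟨x', hx', ex⟩ :=
      Function.Periodic.exists_mem_Ico₀ (f := fun x => g (x, θ)) (fun x => h1 x θ) hp x
    obtain ⟨θ', hθ', eθ⟩ :=
      Function.Periodic.exists_mem_Ico₀ (f := fun θ => g (x', θ)) (fun θ => h2 x' θ) hq θ
    rw [ex, eθ]
    exact hM _ ⟨⟨hx'.1, hθ'.1⟩, ⟨hx'.2.le, hθ'.2.le⟩⟩
  exact ⟨M, (norm_nonneg _).trans (hb 0), hb⟩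

lemma exists_lipschitz_of_periodic {h : ℝ → ℝ → ℂ} (hsm : ContDiff ℝ 1 (Function.uncurry h))
    {p q : ℝ} (hp : 0 < p) (hq : 0 < q)
    (h1 : ∀ x θ, h (x + p) θ = h x θ) (h2 : ∀ x θ, h x (θ + q) = h x θ) :
    ∃ L, 0 ≤ L ∧ ∀ x x' θ, ‖h x θ - h x' θ‖ ≤ L * |x - x'| := by
  have hcont : Continuous (fderiv ℝ (Function.uncurry h)) := hsm.continuous_fderiv one_ne_zero
  have hper : ∀ v : ℝ × ℝ, (∀ z, Function.uncurry h (z + v) = Function.uncurry h z) →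
      ∀ z, fderiv ℝ (Function.uncurry h) (z + v) = fderiv ℝ (Function.uncurry h) z := by
    intro v hv z
    rw [← fderiv_comp_add_right]
    congr 1
    exact funext hv
  obtain ⟨L, hL0, hL⟩ := exists_norm_le_of_periodic hcont hp hq
    (fun x θ => by
      simpa using hper (p, 0) (fun z => by simpa [Function.uncurry] using h1 z.1 z.2) (x, θ))
    (fun x θ => by
      simpa using hper (0, q) (fun z => by simpa [Function.uncurry] using h2 z.1 z.2) (x, θ))
  refine ⟨L, hL0, fun x x' θ => ?_⟩
  have := Convex.norm_image_sub_le_of_norm_fderiv_le (𝕜 := ℝ) (f := Function.uncurry h)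
    (s := Set.univ) (C := L) (x := (x', θ)) (y := (x, θ))
    (fun z _ => (hsm.differentiable one_ne_zero) z) (fun z _ => hL z) convex_univ trivial trivial
  simpa [Function.uncurry, Prod.norm_def] using this

end PeriodicFunctions

section CuspKernel

/-- The contribution of the coset with bottom row `(c, d)` to the lift of `fT T h` along the
horocycle at height `y`, in the coordinate `t = (x + d / c) / y`, where `α = a / c` and
`R = 1 / (T y)`. -/
noncomputable def cuspKernel (h : ℝ → ℝ → ℂ) (R y : ℝ) (c : ℕ) (α t : ℝ) : ℂ :=
  if (c : ℝ) ^ 2 * (1 + t ^ 2) ≤ R then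
    h (α - t / ((c : ℝ) ^ 2 * y * (1 + t ^ 2))) (2 * Real.arctan t - Real.pi)
  else 0

lemma arg_add_I (t : ℝ) : Complex.arg ((t : ℂ) + Complex.I) = Real.pi / 2 - Real.arctan t := by
  have hs : 0 < √(1 + t ^ 2) := Real.sqrt_pos.2 (by positivity)
  have h1 := Real.arctan_lt_pi_div_two t
  have h2 := Real.neg_pi_div_two_lt_arctan t
  have h := Complex.arg_mul_cos_add_sin_mul_I hs (θ := Real.pi / 2 - Real.arctan t)
    ⟨by linarith [Real.pi_pos], by linarith [Real.pi_pos]⟩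
  rw [← h]
  congr 1
  rw [← Complex.ofReal_cos, ← Complex.ofReal_sin, Real.cos_pi_div_two_sub,
    Real.sin_pi_div_two_sub, Real.sin_arctan, Real.cos_arctan]
  have hs' : ((√(1 + t ^ 2) : ℝ) : ℂ) ≠ 0 := by exact_mod_cast hs.ne'
  push_cast
  field_simp

lemma fT_mobius_eq_cuspKernel (h : ℝ → ℝ → ℂ) {T y : ℝ} (hT : 0 < T) (hy : 0 < y) (x : ℝ)
    {c : ℕ} (hc : 1 ≤ c) {a b d : ℤ} (habd : a * d - b * (c : ℤ) = 1) :
    fT T h (((a : ℂ) * ((x : ℂ) + (y : ℂ) * Complex.I) + (b : ℂ)) /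
        ((c : ℂ) * ((x : ℂ) + (y : ℂ) * Complex.I) + (d : ℂ)))
      (0 - 2 * Complex.arg ((c : ℂ) * ((x : ℂ) + (y : ℂ) * Complex.I) + (d : ℂ)))
    = cuspKernel h (1 / (T * y)) y c ((a : ℝ) / c) ((x + (d : ℝ) / c) / y) := by
  have hc0 : (0 : ℝ) < c := by exact_mod_cast hc
  have hcC : (c : ℂ) ≠ 0 := by exact_mod_cast hc0.ne'
  have hyC : (y : ℂ) ≠ 0 := by exact_mod_cast hy.ne'
  obtain ⟨t, ht⟩ : ∃ t, t = (x + (d : ℝ) / c) / y := ⟨_, rfl⟩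
  rw [← ht]
  have hx : x = y * t - d / c := by rw [ht]; field_simp; ring
  have hden : (c : ℂ) * ((x : ℂ) + (y : ℂ) * Complex.I) + (d : ℂ)
      = ((c * y : ℝ) : ℂ) * ((t : ℂ) + Complex.I) := by
    rw [hx]; push_cast; field_simp; ring
  have htI : (t : ℂ) + Complex.I ≠ 0 := by
    intro h0
    simpa using congrArg Complex.im h0
  have htt : (1 + (t : ℂ) ^ 2) ≠ 0 := by
    have : (1 + t ^ 2 : ℝ) ≠ 0 := by positivity
    exact_mod_cast this
  have hb : (b : ℂ) = ((a : ℂ) * d - 1) / c := by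
    rw [eq_div_iff hcC]
    have : (a : ℂ) * d - b * c = 1 := by exact_mod_cast habd
    linear_combination -this
  have hfrac : ((a : ℂ) * ((x : ℂ) + (y : ℂ) * Complex.I) + (b : ℂ)) /
        ((c : ℂ) * ((x : ℂ) + (y : ℂ) * Complex.I) + (d : ℂ))
      = (((a : ℝ) / c - t / ((c : ℝ) ^ 2 * y * (1 + t ^ 2)) : ℝ) : ℂ)
        + ((1 / ((c : ℝ) ^ 2 * y * (1 + t ^ 2)) : ℝ) : ℂ) * Complex.I := by
    have hI : (1 + (t : ℂ) ^ 2) = (t + Complex.I) * (t - Complex.I) := by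
      ring_nf; simp; ring
    rw [hden, div_eq_iff (mul_ne_zero (by exact_mod_cast (mul_pos hc0 hy).ne') htI), hx, hb]
    push_cast
    have e1 : ((t : ℂ) - Complex.I) / ((c : ℂ) ^ 2 * y * (1 + (t : ℂ) ^ 2)) *
        ((c : ℂ) * y * (t + Complex.I)) = 1 / c := by
      rw [div_mul_eq_mul_div, div_eq_div_iff (mul_ne_zero (mul_ne_zero (pow_ne_zero _ hcC) hyC) htt) hcC,
        hI]
      ring
    have e2 : ((a : ℂ) / c - t / ((c : ℂ) ^ 2 * y * (1 + (t : ℂ) ^ 2)) +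
        1 / ((c : ℂ) ^ 2 * y * (1 + (t : ℂ) ^ 2)) * Complex.I) * ((c : ℂ) * y * (t + Complex.I))
        = a / c * ((c : ℂ) * y * (t + Complex.I)) -
          ((t : ℂ) - Complex.I) / ((c : ℂ) ^ 2 * y * (1 + (t : ℂ) ^ 2)) *
        ((c : ℂ) * y * (t + Complex.I)) := by ring
    rw [e2, e1]
    field_simp
    ring
  rw [hfrac, hden, Complex.arg_real_mul _ (by positivity), arg_add_I, fT, cuspKernel]
  have hiff : T ≤ 1 / ((c : ℝ) ^ 2 * y * (1 + t ^ 2)) ↔ (c : ℝ) ^ 2 * (1 + t ^ 2) ≤ 1 / (T * y) := by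
    rw [le_div_iff₀ (by positivity), le_div_iff₀ (by positivity)]
    constructor <;> intro h <;> linarith
  simp only [Complex.add_im, Complex.ofReal_im, Complex.mul_im, Complex.ofReal_re, Complex.I_im,
    mul_one, Complex.I_re, mul_zero, add_zero, zero_add, Complex.add_re, Complex.mul_re, sub_zero,
    hiff]
  have : 0 - 2 * (Real.pi / 2 - Real.arctan t) = 2 * Real.arctan t - Real.pi := by ring
  rw [this]

lemma integral_arctan_eq {H : ℝ → ℂ} (hper : ∀ θ, H (θ + 2 * Real.pi) = H θ) :
    ∫ t : ℝ, ((1 / (1 + t ^ 2) : ℝ) : ℂ) * H (2 * Real.arctan t - Real.pi)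
      = 2⁻¹ * ∫ θ in (0 : ℝ)..(2 * Real.pi), H θ := by
  have h := integral_image_eq_integral_abs_deriv_smul (s := Set.univ) (f := Real.arctan)
    (f' := fun t => 1 / (1 + t ^ 2)) MeasurableSet.univ
    (fun t _ => (Real.hasDerivAt_arctan t).hasDerivWithinAt) Real.arctan_injective.injOn
    (fun s => H (2 * s - Real.pi))
  rw [Set.image_univ, Real.range_arctan, setIntegral_univ] at h
  have h2 : ∫ t : ℝ, ((1 / (1 + t ^ 2) : ℝ) : ℂ) * H (2 * Real.arctan t - Real.pi)
      = ∫ t : ℝ, |1 / (1 + t ^ 2)| • H (2 * Real.arctan t - Real.pi) := by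
    congr 1
    ext t
    rw [abs_of_pos (by positivity), Complex.real_smul]
  rw [h2, ← h, ← integral_Ioc_eq_integral_Ioo,
    ← intervalIntegral.integral_of_le (by linarith [Real.pi_pos]),
    intervalIntegral.integral_comp_mul_sub (fun θ => H θ) two_ne_zero]
  have h3 := Function.Periodic.intervalIntegral_add_eq (f := H) hper (-(2 * Real.pi)) 0
  rw [neg_add_cancel, zero_add] at h3
  rw [← h3, Complex.real_smul]
  push_cast
  congr 2 <;> ring

end CuspKernel

section Unfolding

open Finset

lemma hasSum_intervalIntegral_residue {c : ℕ} [NeZero c] {F : ZMod c → ℝ → ℂ}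
    (hF : ∀ r, Integrable (F r)) :
    HasSum (fun d : ℤ => ∫ x in (0 : ℝ)..1, F (d : ZMod c) (x + (d : ℝ) / c))
      (∑ r, ∫ x, F r x) := by
  have hc0 : (c : ℝ) ≠ 0 := by exact_mod_cast NeZero.ne c
  have key : ∀ r : ZMod c, HasSum (fun d : ℤ => if (d : ZMod c) = r then
      ∫ x in (0 : ℝ)..1, F (d : ZMod c) (x + (d : ℝ) / c) else 0) (∫ x, F r x) := by
    intro r
    have hinj : Function.Injective (fun q : ℤ => (r.val : ℤ) + c * q) := by
      intro p q h
      have hcz : (c : ℤ) ≠ 0 := by exact_mod_cast NeZero.ne c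
      exact mul_left_cancel₀ hcz (add_left_cancel h)
    have hmem : ∀ q : ℤ, (((r.val : ℤ) + c * q : ℤ) : ZMod c) = r := by
      intro q; push_cast; simp
    rw [← hinj.hasSum_iff]
    · have h := ((hF r).comp_add_right ((r.val : ℝ) / c)).hasSum_intervalIntegral_comp_add_int
      rw [integral_add_right_eq_self (F r)] at h
      have e : ∀ q : ℤ, (if (((r.val : ℤ) + c * q : ℤ) : ZMod c) = r then
          ∫ x in (0 : ℝ)..1, F (((r.val : ℤ) + c * q : ℤ) : ZMod c)
            (x + (((r.val : ℤ) + c * q : ℤ) : ℝ) / c) else 0)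
          = ∫ x in (0 : ℝ)..1, F r (x + q + (r.val : ℝ) / c) := by
        intro q
        rw [hmem, if_pos rfl]
        congr 1
        ext x
        congr 1
        push_cast
        field_simp
        ring
      rw [← funext e] at h
      exact h
    · intro d hd
      rw [if_neg]
      intro hdr
      apply hd
      refine ⟨d / c, ?_⟩
      have := ZMod.val_intCast (n := c) d
      rw [hdr] at this
      rw [this]
      exact Int.emod_add_mul_ediv d c
  have := hasSum_sum (s := Finset.univ) fun r _ => key r
  simpa using this

lemma integral_tsum_residue {c : ℕ} [NeZero c] {F : ZMod c → ℝ → ℂ}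
    (hF : ∀ r, Integrable (F r)) {B : ℝ} (hB : ∀ r s, B < |s| → F r s = 0) :
    IntervalIntegrable (fun x : ℝ => ∑' d : ℤ, F (d : ZMod c) (x + (d : ℝ) / c)) volume 0 1 ∧
    ∫ x in (0 : ℝ)..1, ∑' d : ℤ, F (d : ZMod c) (x + (d : ℝ) / c) = ∑ r, ∫ x, F r x := by
  have hc0 : (0 : ℝ) < c := by exact_mod_cast Nat.pos_of_ne_zero (NeZero.ne c)
  set m : ℤ := ⌈c * (B + 1)⌉ with hm
  have hzero : ∀ d ∉ Icc (-m) m, ∀ x ∈ Set.Icc (0 : ℝ) 1,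
      F (d : ZMod c) (x + (d : ℝ) / c) = 0 := by
    intro d hd x hx
    apply hB
    have hd2 : (c : ℝ) * (B + 1) < |(d : ℝ)| := by
      have h1 : m < |d| := by
        by_contra hcon
        exact hd (mem_Icc.2 (abs_le.1 (not_lt.1 hcon)))
      have h2 : (m : ℝ) < |(d : ℝ)| := by exact_mod_cast h1
      exact (Int.le_ceil _).trans_lt h2
    have h3 : B + 1 < |(d : ℝ) / c| := by
      rw [abs_div, abs_of_pos hc0, lt_div_iff₀ hc0]; linarith
    have h4 : |(d : ℝ) / c| ≤ |x + (d : ℝ) / c| + |x| := by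
      have := abs_sub (x + (d : ℝ) / c) x
      simpa using this
    have h5 : |x| ≤ 1 := abs_le.2 ⟨by linarith [hx.1], hx.2⟩
    linarith
  have hint : ∀ d : ℤ, IntervalIntegrable (fun x : ℝ => F (d : ZMod c) (x + (d : ℝ) / c))
      volume 0 1 := fun d => ((hF d).comp_add_right ((d : ℝ) / c)).intervalIntegrable
  have heq : Set.EqOn (fun x : ℝ => ∑ d ∈ Icc (-m) m, F (d : ZMod c) (x + (d : ℝ) / c))
      (fun x : ℝ => ∑' d : ℤ, F (d : ZMod c) (x + (d : ℝ) / c)) (Set.uIcc 0 1) := by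
    intro x hx
    rw [Set.uIcc_of_le zero_le_one] at hx
    exact (tsum_eq_sum fun d hd => hzero d hd x hx).symm
  refine ⟨(IntervalIntegrable.sum (Icc (-m) m) fun d _ => hint d).congr
    (g := fun x : ℝ => ∑' d : ℤ, F (d : ZMod c) (x + (d : ℝ) / c)) ?_, ?_⟩
  · intro x hx
    rw [Finset.sum_apply]
    exact heq (Set.uIoc_subset_uIcc hx)
  · rw [← intervalIntegral.integral_congr heq,
      intervalIntegral.integral_finsetSum fun d _ => hint d]
    refine (hasSum_sum_of_ne_finset_zero fun d hd => ?_).unique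
      (hasSum_intervalIntegral_residue hF)
    rw [intervalIntegral.integral_congr (g := fun _ => 0), intervalIntegral.integral_zero]
    intro x hx
    rw [Set.uIcc_of_le zero_le_one] at hx
    exact hzero d hd x hx

lemma measurable_cuspKernel {h : ℝ → ℝ → ℂ} (hc : Continuous (Function.uncurry h))
    (R y : ℝ) (c : ℕ) (α : ℝ) : Measurable (cuspKernel h R y c α) := by
  unfold cuspKernel
  refine Measurable.ite (measurableSet_le (by fun_prop) (by fun_prop)) ?_ measurable_const
  exact hc.measurable.comp (f := fun t : ℝ =>
    (α - t / ((c : ℝ) ^ 2 * y * (1 + t ^ 2)), 2 * Real.arctan t - Real.pi)) (by fun_prop)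

lemma cuspKernel_eq_zero (h : ℝ → ℝ → ℂ) {R y : ℝ} {c : ℕ} (hc : 1 ≤ c) (α : ℝ) {t : ℝ}
    (ht : √R < |t|) : cuspKernel h R y c α t = 0 := by
  rw [cuspKernel, if_neg]
  intro hcon
  have hc1 : (1 : ℝ) ≤ (c : ℝ) ^ 2 := one_le_pow₀ (by exact_mod_cast hc)
  have : t ^ 2 ≤ R := by nlinarith [sq_nonneg t]
  exact absurd ht (not_lt.2 (Real.abs_le_sqrt this))

lemma integrable_cuspKernel {h : ℝ → ℝ → ℂ} (hcont : Continuous (Function.uncurry h)) {M : ℝ}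
    (hM : ∀ x θ, ‖h x θ‖ ≤ M) (R y : ℝ) {c : ℕ} (hc : 1 ≤ c) (α : ℝ) :
    Integrable (cuspKernel h R y c α) := by
  have hM0 : 0 ≤ M := (norm_nonneg _).trans (hM 0 0)
  refine Integrable.mono' (g := (Set.Icc (-√R) √R).indicator fun _ => M)
    ((integrable_indicator_iff measurableSet_Icc).2 (by simp))
    (measurable_cuspKernel hcont R y c α).aestronglyMeasurable (Filter.Eventually.of_forall ?_)
  intro t
  by_cases ht : t ∈ Set.Icc (-√R) √R
  · rw [Set.indicator_of_mem ht, cuspKernel]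
    split_ifs
    · exact hM _ _
    · simpa using hM0
  · rw [Set.indicator_of_notMem ht, cuspKernel_eq_zero h hc, norm_zero]
    by_contra hcon
    exact ht (abs_le.1 (not_lt.1 hcon))

lemma cuspKernel_add_intCast {h : ℝ → ℝ → ℂ} (hper : ∀ x θ, h (x + 1) θ = h x θ)
    (R y : ℝ) (c : ℕ) (α t : ℝ) (n : ℤ) :
    cuspKernel h R y c (α + n) t = cuspKernel h R y c α t := by
  simp only [cuspKernel]
  have hp : Function.Periodic (fun x => h x (2 * Real.arctan t - Real.pi)) 1 := fun x => hper x _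
  have := hp.int_mul n (α - t / ((c : ℝ) ^ 2 * y * (1 + t ^ 2)))
  simp only [mul_one] at this
  rw [add_sub_right_comm, this]

lemma cuspKernel_inv_val {h : ℝ → ℝ → ℂ} (hper : ∀ x θ, h (x + 1) θ = h x θ)
    (R y : ℝ) {c : ℕ} [NeZero c] {a b d : ℤ} (habd : a * d - b * (c : ℤ) = 1) (t : ℝ) :
    cuspKernel h R y c ((((d : ZMod c)⁻¹).val : ℝ) / c) t = cuspKernel h R y c ((a : ℝ) / c) t := by
  have hc0 : (c : ℝ) ≠ 0 := by exact_mod_cast NeZero.ne c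
  have h1 : (d : ZMod c)⁻¹ = a := by
    apply ZMod.inv_eq_of_mul_eq_one
    have := congrArg (Int.cast : ℤ → ZMod c) habd
    push_cast at this
    simpa [mul_comm] using this
  have h2 : ((((d : ZMod c)⁻¹).val : ℤ) : ℝ) = ((a % c : ℤ) : ℝ) := by
    rw [h1, ZMod.val_intCast]
  have h3 : (a : ℝ) / c = (((d : ZMod c)⁻¹).val : ℝ) / c + ((a / c : ℤ) : ℝ) := by
    have h4 : ((a % c : ℤ) : ℝ) + c * ((a / c : ℤ) : ℝ) = a := by
      exact_mod_cast Int.emod_add_mul_ediv a c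
    rw [Int.cast_natCast] at h2
    rw [h2]
    field_simp
    linarith
  rw [h3, cuspKernel_add_intCast hper]

lemma sum_isUnit_inv_eq {c : ℕ} [NeZero c] (I : ℕ → ℂ) :
    (∑ r : ZMod c with IsUnit r, I (r⁻¹).val) = ∑ j ∈ range c with j.Coprime c, I j := by
  have hunit : ∀ r : ZMod c, IsUnit r → r⁻¹⁻¹ = r := fun r hr =>
    ZMod.inv_eq_of_mul_eq_one _ _ _ (ZMod.inv_mul_of_unit r hr)
  have hinv : ∀ r : ZMod c, IsUnit r → IsUnit r⁻¹ := fun r hr =>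
    IsUnit.of_mul_eq_one r (ZMod.inv_mul_of_unit r hr)
  refine Finset.sum_bij' (fun r _ => (r⁻¹).val) (fun j _ => (j : ZMod c)⁻¹) ?_ ?_ ?_ ?_ ?_
  · intro r hr
    simp only [mem_filter, mem_univ, true_and, mem_range] at hr ⊢
    refine ⟨ZMod.val_lt _, ?_⟩
    rw [← ZMod.isUnit_iff_coprime, ZMod.natCast_zmod_val]
    exact hinv r hr
  · intro j hj
    simp only [mem_filter, mem_univ, true_and, mem_range] at hj ⊢
    exact hinv _ ((ZMod.isUnit_iff_coprime _ _).2 hj.2)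
  · intro r hr
    simp only [mem_filter, mem_univ, true_and] at hr
    simp only [ZMod.natCast_zmod_val]
    exact hunit r hr
  · intro j hj
    simp only [mem_filter, mem_range] at hj
    rw [hunit _ ((ZMod.isUnit_iff_coprime _ _).2 hj.2), ZMod.val_cast_of_lt hj.1]
  · intro r _
    rfl

/-- Unfolding of the contribution of the cosets with lower left entry `c` along a full closed
horocycle. -/
lemma integral_tsum_cuspKernel {h : ℝ → ℝ → ℂ} (hcont : Continuous (Function.uncurry h))
    (hper : ∀ x θ, h (x + 1) θ = h x θ) {M : ℝ} (hM : ∀ x θ, ‖h x θ‖ ≤ M) (R : ℝ) {y : ℝ}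
    (hy : 0 < y) {c : ℕ} (hc : 1 ≤ c) {a b : ℤ → ℤ}
    (hab : ∀ d : ℤ, Int.gcd (c : ℤ) d = 1 → a d * d - b d * (c : ℤ) = 1) :
    IntervalIntegrable (fun x : ℝ => ∑' d : ℤ, if Int.gcd (c : ℤ) d = 1 then
      cuspKernel h R y c ((a d : ℝ) / c) ((x + (d : ℝ) / c) / y) else 0) volume 0 1 ∧
    (∫ x in (0 : ℝ)..1, ∑' d : ℤ, if Int.gcd (c : ℤ) d = 1 then
      cuspKernel h R y c ((a d : ℝ) / c) ((x + (d : ℝ) / c) / y) else 0) =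
    y * ∑ j ∈ range c with j.Coprime c, ∫ t, cuspKernel h R y c ((j : ℝ) / c) t := by
  classical
  have : NeZero c := ⟨by omega⟩
  set F : ZMod c → ℝ → ℂ := fun r s =>
    if IsUnit r then cuspKernel h R y c (((r⁻¹).val : ℝ) / c) (s / y) else 0 with hF
  have hFd : ∀ (d : ℤ) (x : ℝ), (if Int.gcd (c : ℤ) d = 1 then
      cuspKernel h R y c ((a d : ℝ) / c) ((x + (d : ℝ) / c) / y) else 0)
      = F (d : ZMod c) (x + (d : ℝ) / c) := by
    intro d x
    have hiff : IsUnit (d : ZMod c) ↔ Int.gcd (c : ℤ) d = 1 := by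
      rw [ZMod.coe_int_isUnit_iff_isCoprime, Int.isCoprime_iff_gcd_eq_one]
    simp only [hF, hiff]
    split_ifs with hg
    · rw [cuspKernel_inv_val hper R y (hab d hg)]
    · rfl
  simp_rw [hFd]
  have hint : ∀ r, Integrable (F r) := by
    intro r
    simp only [hF]
    by_cases hr : IsUnit r
    · simp only [if_pos hr]
      exact (integrable_cuspKernel hcont hM R y hc _).comp_div hy.ne'
    · simp [if_neg hr]
  obtain ⟨h1, h2⟩ := integral_tsum_residue hint (B := √R * y) (by
    intro r s hs
    simp only [hF]
    split_ifs
    · apply cuspKernel_eq_zero h hc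
      rwa [abs_div, abs_of_pos hy, lt_div_iff₀ hy]
    · rfl)
  refine ⟨h1, h2.trans ?_⟩
  rw [← sum_isUnit_inv_eq fun j => ∫ t, cuspKernel h R y c ((j : ℝ) / c) t, Finset.mul_sum,
    Finset.sum_filter]
  refine Finset.sum_congr rfl fun r _ => ?_
  simp only [hF]
  split_ifs
  · rw [Measure.integral_comp_div, abs_of_pos hy, Complex.real_smul]
  · simp

end Unfolding

section Asymptotics

open Finset

lemma norm_sum_cuspKernel_sub_le {h : ℝ → ℝ → ℂ} (hcont : Continuous (Function.uncurry h))
    (hper : ∀ x θ, h (x + 1) θ = h x θ) {M L : ℝ} (hM : ∀ x θ, ‖h x θ‖ ≤ M)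
    (hL : ∀ x x' θ, ‖h x θ - h x' θ‖ ≤ L * |x - x'|) (hL0 : 0 ≤ L) {R : ℝ} (hR : 0 < R) (y t : ℝ) :
    ‖∑ c ∈ Ioc 0 ⌊√R⌋₊, ∑ j ∈ range c with j.Coprime c, cuspKernel h R y c ((j : ℝ) / c) t -
        ((3 / Real.pi ^ 2 * R : ℝ) : ℂ) * (((1 / (1 + t ^ 2) : ℝ) : ℂ) *
          ∫ x in (0 : ℝ)..1, h x (2 * Real.arctan t - Real.pi))‖
      ≤ (2 * L + 2 * M) * (R ^ ((3 : ℝ) / 4) * (1 + ‖t‖ ^ 2) ^ (-(3 / 2 : ℝ) / 2)) := by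
  set θ := 2 * Real.arctan t - Real.pi with hθ
  set I := ∫ x in (0 : ℝ)..1, h x θ with hI
  have ht : 0 < 1 + t ^ 2 := by positivity
  set Y := √(R / (1 + t ^ 2)) with hY
  have hY0 : 0 ≤ Y := Real.sqrt_nonneg _
  have hYsq : Y ^ 2 = R / (1 + t ^ 2) := Real.sq_sqrt (by positivity)
  have hYpow : Y * √Y = R ^ ((3 : ℝ) / 4) * (1 + ‖t‖ ^ 2) ^ (-(3 / 2 : ℝ) / 2) := by
    have hpos : 0 < R / (1 + t ^ 2) := by positivity
    rw [hY, Real.sqrt_eq_rpow, Real.sqrt_eq_rpow, ← Real.rpow_mul hpos.le, ← Real.rpow_add hpos,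
      Real.div_rpow hR.le ht.le, Real.norm_eq_abs, sq_abs, div_eq_mul_inv, ← Real.rpow_neg ht.le]
    norm_num
  have hI_le : ‖I‖ ≤ M := by
    have := intervalIntegral.norm_integral_le_of_norm_le_const (a := (0 : ℝ)) (b := 1)
      (f := fun x => h x θ) (fun x _ => hM x θ)
    simpa using this
  have hiff : ∀ c : ℕ, (c : ℝ) ^ 2 * (1 + t ^ 2) ≤ R ↔ c ≤ ⌊Y⌋₊ := by
    intro c
    rw [Nat.le_floor_iff hY0, hY, Real.le_sqrt (by positivity), le_div_iff₀ ht]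
    positivity
  have hfloor : ⌊Y⌋₊ ≤ ⌊√R⌋₊ :=
    Nat.floor_le_floor (Real.sqrt_le_sqrt (div_le_self hR.le (by nlinarith [sq_nonneg t])))
  set k : ℕ → ℝ → ℂ := fun c x => h (x - t / ((c : ℝ) ^ 2 * y * (1 + t ^ 2))) θ with hk
  have hsum : ∑ c ∈ Ioc 0 ⌊√R⌋₊, ∑ j ∈ range c with j.Coprime c, cuspKernel h R y c ((j : ℝ) / c) t
      = ∑ c ∈ Ioc 0 ⌊Y⌋₊, ∑ j ∈ range c with j.Coprime c, k c ((j : ℝ) / c) := by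
    symm
    refine Finset.sum_subset_zero_on_sdiff (Ioc_subset_Ioc_right hfloor) ?_ ?_
    · intro c hc
      simp only [mem_sdiff, mem_Ioc, not_and, not_le] at hc
      refine Finset.sum_eq_zero fun j _ => ?_
      rw [cuspKernel, if_neg]
      rw [hiff]
      exact not_le.2 (hc.2 hc.1.1)
    · intro c hc
      refine Finset.sum_congr rfl fun j _ => ?_
      rw [cuspKernel, if_pos ((hiff c).2 (mem_Ioc.1 hc).2)]
  have hkI : ∀ c, ∫ x in (0 : ℝ)..1, k c x = I := by
    intro c
    have hp : Function.Periodic (fun x => h x θ) 1 := fun x => hper x θ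
    have := hp.intervalIntegral_add_eq (-(t / ((c : ℝ) ^ 2 * y * (1 + t ^ 2)))) 0
    simp only [hk]
    rw [intervalIntegral.integral_comp_sub_right (fun x => h x θ), zero_sub, sub_eq_neg_add,
      this, zero_add]
  have hhθ : Continuous fun x => h x θ := hcont.comp (by fun_prop : Continuous fun x : ℝ => (x, θ))
  have hkb : ∀ c ∈ Ioc 0 ⌊Y⌋₊, ‖∑ j ∈ range c with j.Coprime c, k c ((j : ℝ) / c)
      - c.totient * I‖ ≤ L * c.divisors.card := by
    intro c hc
    rw [← hkI c]
    refine norm_sum_coprime_sub_integral_le ?_ ?_ (mem_Ioc.1 hc).1.ne'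
    · exact hhθ.comp (by fun_prop :
        Continuous fun x : ℝ => x - t / ((c : ℝ) ^ 2 * y * (1 + t ^ 2)))
    · intro x x'
      have := hL (x - t / ((c : ℝ) ^ 2 * y * (1 + t ^ 2)))
        (x' - t / ((c : ℝ) ^ 2 * y * (1 + t ^ 2))) θ
      rwa [sub_sub_sub_cancel_right] at this
  have hsplit : ∑ c ∈ Ioc 0 ⌊Y⌋₊, ∑ j ∈ range c with j.Coprime c, k c ((j : ℝ) / c) -
        ((3 / Real.pi ^ 2 * R : ℝ) : ℂ) * (((1 / (1 + t ^ 2) : ℝ) : ℂ) * I)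
      = ∑ c ∈ Ioc 0 ⌊Y⌋₊, (∑ j ∈ range c with j.Coprime c, k c ((j : ℝ) / c) - c.totient * I)
        + ((∑ c ∈ Ioc 0 ⌊Y⌋₊, (c.totient : ℝ) - 3 / Real.pi ^ 2 * Y ^ 2 : ℝ) : ℂ) * I := by
    rw [Finset.sum_sub_distrib, ← Finset.sum_mul, hYsq]
    push_cast
    ring
  rw [hsum, hsplit, ← hYpow]
  refine (norm_add_le _ _).trans ?_
  have b1 := (norm_sum_le_of_le _ hkb).trans_eq (Finset.mul_sum _ _ _).symm
  have b2 := mul_le_mul_of_nonneg_left (sum_card_divisors_le hY0) hL0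
  have b3 : ‖((∑ c ∈ Ioc 0 ⌊Y⌋₊, (c.totient : ℝ) - 3 / Real.pi ^ 2 * Y ^ 2 : ℝ) : ℂ) * I‖
      ≤ 2 * (Y * √Y) * M := by
    rw [norm_mul, Complex.norm_real, Real.norm_eq_abs]
    exact mul_le_mul (abs_sum_totient_sub_le hY0) hI_le (norm_nonneg _) (by positivity)
  linarith

lemma norm_integral_cuspKernel_sub_le {h : ℝ → ℝ → ℂ} (hcont : Continuous (Function.uncurry h))
    (hper1 : ∀ x θ, h (x + 1) θ = h x θ) (hper2 : ∀ x θ, h x (θ + 2 * Real.pi) = h x θ)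
    {M L : ℝ} (hM : ∀ x θ, ‖h x θ‖ ≤ M)
    (hL : ∀ x x' θ, ‖h x θ - h x' θ‖ ≤ L * |x - x'|) (hL0 : 0 ≤ L) {R : ℝ} (hR : 0 < R) (y : ℝ) :
    ‖(∑ c ∈ Ioc 0 ⌊√R⌋₊, ∑ j ∈ range c with j.Coprime c,
        ∫ t, cuspKernel h R y c ((j : ℝ) / c) t) -
        ((3 / (2 * Real.pi ^ 2) * R : ℝ) : ℂ) *
          ∫ θ in (0 : ℝ)..(2 * Real.pi), ∫ x in (0 : ℝ)..1, h x θ‖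
      ≤ (2 * L + 2 * M) * R ^ ((3 : ℝ) / 4) *
        ∫ t : ℝ, (1 + ‖t‖ ^ 2) ^ (-(3 / 2 : ℝ) / 2) := by
  set H : ℝ → ℂ := fun θ => ∫ x in (0 : ℝ)..1, h x θ with hH
  have hHc : Continuous H := by
    refine intervalIntegral.continuous_parametric_intervalIntegral_of_continuous'
      (f := fun θ x => h x θ) ?_ 0 1
    exact hcont.comp continuous_swap
  have hHM : ∀ θ, ‖H θ‖ ≤ M := fun θ => by
    have := intervalIntegral.norm_integral_le_of_norm_le_const (a := (0 : ℝ)) (b := 1)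
      (f := fun x => h x θ) (fun x _ => hM x θ)
    simpa using this
  have hHper : ∀ θ, H (θ + 2 * Real.pi) = H θ := fun θ => by simp only [hH, hper2]
  have hKint : ∀ c ∈ Ioc 0 ⌊√R⌋₊, ∀ j : ℕ, Integrable (cuspKernel h R y c ((j : ℝ) / c)) :=
    fun c hc j => integrable_cuspKernel hcont hM R y (mem_Ioc.1 hc).1 _
  have hS : ∑ c ∈ Ioc 0 ⌊√R⌋₊, ∑ j ∈ range c with j.Coprime c,
        ∫ t, cuspKernel h R y c ((j : ℝ) / c) t
      = ∫ t, ∑ c ∈ Ioc 0 ⌊√R⌋₊, ∑ j ∈ range c with j.Coprime c,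
        cuspKernel h R y c ((j : ℝ) / c) t := by
    rw [integral_finsetSum _ fun c hc => integrable_finsetSum _ fun j _ => hKint c hc j]
    exact Finset.sum_congr rfl fun c hc =>
      (integral_finsetSum _ fun j _ => hKint c hc j).symm
  have hmain : ((3 / (2 * Real.pi ^ 2) * R : ℝ) : ℂ) * ∫ θ in (0 : ℝ)..(2 * Real.pi), H θ
      = ∫ t : ℝ, ((3 / Real.pi ^ 2 * R : ℝ) : ℂ) * (((1 / (1 + t ^ 2) : ℝ) : ℂ) *
          H (2 * Real.arctan t - Real.pi)) := by
    rw [integral_const_mul, integral_arctan_eq hHper]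
    push_cast
    ring
  have hgint : Integrable fun t : ℝ => ((1 / (1 + t ^ 2) : ℝ) : ℂ) *
      H (2 * Real.arctan t - Real.pi) := by
    have h1 : Integrable fun t : ℝ => ((1 / (1 + t ^ 2) : ℝ) : ℂ) := by
      simp only [one_div]
      exact integrable_inv_one_add_sq.ofReal
    refine h1.mul_bdd (c := M) ?_ (Filter.Eventually.of_forall fun t => hHM _)
    exact (hHc.comp (by fun_prop : Continuous fun t : ℝ =>
      2 * Real.arctan t - Real.pi)).aestronglyMeasurable
  rw [hS, hmain, ← integral_sub (integrable_finsetSum _ fun c hc =>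
    integrable_finsetSum _ fun j _ => hKint c hc j) (hgint.const_mul _)]
  have hJ : Integrable fun t : ℝ => (1 + ‖t‖ ^ 2) ^ (-(3 / 2 : ℝ) / 2) :=
    integrable_rpow_neg_one_add_norm_sq (by norm_num)
  rw [mul_assoc, ← integral_const_mul, ← integral_const_mul]
  refine norm_integral_le_of_norm_le ((hJ.const_mul _).const_mul _)
    (Filter.Eventually.of_forall fun t => ?_)
  exact norm_sum_cuspKernel_sub_le hcont hper1 hM hL hL0 hR y t

lemma lift_fT_eq_sum_cuspKernel (h : ℝ → ℝ → ℂ) {a b : ℕ → ℤ → ℤ}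
    (hab : ∀ (c : ℕ) (d : ℤ), 1 ≤ c → Int.gcd (c : ℤ) d = 1 →
      a c d * d - b c d * (c : ℤ) = 1) {T y : ℝ} (hT : 0 < T) (hy : 0 < y) (hyT : y < T) (x : ℝ) :
    lift a b (fT T h) ((x : ℂ) + (y : ℂ) * Complex.I) 0 =
      ∑ c ∈ Ioc 0 ⌊√(1 / (T * y))⌋₊, ∑' d : ℤ, if Int.gcd (c : ℤ) d = 1 then
        cuspKernel h (1 / (T * y)) y c ((a c d : ℝ) / c) ((x + (d : ℝ) / c) / y) else 0 := by
  have h0 : fT T h ((x : ℂ) + (y : ℂ) * Complex.I) 0 = 0 := by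
    rw [fT, if_neg]
    simpa using hyT
  have hterm : ∀ (c : ℕ) (d : ℤ), (if 1 ≤ c ∧ Int.gcd (c : ℤ) d = 1 then
      fT T h (((a c d : ℂ) * ((x : ℂ) + (y : ℂ) * Complex.I) + (b c d : ℂ)) /
        ((c : ℂ) * ((x : ℂ) + (y : ℂ) * Complex.I) + (d : ℂ)))
        (0 - 2 * Complex.arg ((c : ℂ) * ((x : ℂ) + (y : ℂ) * Complex.I) + (d : ℂ)))
      else 0) = if 1 ≤ c ∧ Int.gcd (c : ℤ) d = 1 then
        cuspKernel h (1 / (T * y)) y c ((a c d : ℝ) / c) ((x + (d : ℝ) / c) / y) else 0 := by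
    intro c d
    split_ifs with hcd
    · exact fT_mobius_eq_cuspKernel h hT hy x hcd.1 (hab c d hcd.1 hcd.2)
    · rfl
  rw [lift, h0, zero_add]
  simp_rw [hterm]
  rw [tsum_eq_sum (s := Ioc 0 ⌊√(1 / (T * y))⌋₊)]
  · refine Finset.sum_congr rfl fun c hc => tsum_congr fun d => ?_
    have hc1 : 1 ≤ c := (mem_Ioc.1 hc).1
    simp only [hc1, true_and]
  · intro c hc
    refine (tsum_congr fun d => ?_).trans tsum_zero
    split_ifs with hcd
    · have hlt : √(1 / (T * y)) < c := by
        by_contra hcon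
        exact hc (mem_Ioc.2 ⟨hcd.1, Nat.le_floor (not_lt.1 hcon)⟩)
      have hc2 : 1 / (T * y) < (c : ℝ) ^ 2 := (Real.sqrt_lt' (by exact_mod_cast hcd.1)).1 hlt
      rw [cuspKernel, if_neg]
      refine not_le.2 (hc2.trans_le (le_mul_of_one_le_right (sq_nonneg _) ?_))
      linarith [sq_nonneg ((x + (d : ℝ) / c) / y)]
    · rfl

lemma le_quarter_of_max_mul_le_one {T u δ : ℝ} (hT : 2 ≤ T) (hu0 : 0 < u) (hu1 : u ≤ 1)
    (h : max (T ^ 4 * u ^ ((1 : ℝ) / 2)) (T ^ (-(1 : ℝ) / 6)) * u ^ (-δ) ≤ 1) : δ ≤ 1 / 4 := by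
  by_contra! hδ
  have hT0 : 0 < T := by linarith
  have hud : 0 < u ^ (-δ) := by positivity
  have h1 : T ^ 4 * u ^ ((1 : ℝ) / 2) * u ^ (-δ) ≤ 1 :=
    (mul_le_mul_of_nonneg_right (le_max_left _ _) hud.le).trans h
  have h2 : T ^ (-(1 : ℝ) / 6) * u ^ (-δ) ≤ 1 :=
    (mul_le_mul_of_nonneg_right (le_max_right _ _) hud.le).trans h
  have h3 : 1 ≤ u ^ ((1 : ℝ) / 2) * u ^ (-δ) * u ^ (-δ) := by
    rw [← Real.rpow_add hu0, ← Real.rpow_add hu0]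
    exact Real.one_le_rpow_of_pos_of_le_one_of_nonpos hu0 hu1 (by linarith)
  have h4 : T⁻¹ ≤ T ^ (-(1 : ℝ) / 6) := by
    rw [← Real.rpow_neg_one]
    exact Real.rpow_le_rpow_of_exponent_le (by linarith) (by norm_num)
  have h5 : T ^ 4 * T⁻¹ * 1 ≤ T ^ 4 * T ^ (-(1 : ℝ) / 6) *
      (u ^ ((1 : ℝ) / 2) * u ^ (-δ) * u ^ (-δ)) := by gcongr
  have h6 : T ^ 4 * T⁻¹ = T ^ 3 := by field_simp
  have h7 : T ^ 4 * u ^ ((1 : ℝ) / 2) * u ^ (-δ) * (T ^ (-(1 : ℝ) / 6) * u ^ (-δ)) ≤ 1 :=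
    mul_le_one₀ h1 (by positivity) h2
  have h8 : (2 : ℝ) ^ 3 ≤ T ^ 3 := by gcongr
  rw [h6] at h5
  nlinarith

end Asymptotics

/-- Effective shrinking target horocycle equidistribution for complete closed
horocycles (`α = 0`, `β = 1`, `η = 0`) on the modular surface, with `B₁ = 2`,
`μ(Γ\G) = 2π²/3` and `s₁ = s₁′ = 1/2`. -/
theorem stmt_9 (h : ℝ → ℝ → ℂ) (hsm : ContDiff ℝ (⊤ : ℕ∞) (Function.uncurry h))
    (hper1 : ∀ x θ, h (x + 1) θ = h x θ)
    (hper2 : ∀ x θ, h x (θ + 2 * Real.pi) = h x θ)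
    (δ : ℝ) (hδ0 : 0 < δ) (hδ1 : δ ≤ 1/2) :
    ∃ C > 0, ∃ T₀ : ℝ, 2 ≤ T₀ ∧ ∃ r₀ : ℝ, 0 < r₀ ∧ r₀ < 3/4 ∧
      ∀ (a b : ℕ → ℤ → ℤ),
        (∀ (c : ℕ) (d : ℤ), 1 ≤ c → Int.gcd (c : ℤ) d = 1 →
          a c d * d - b c d * (c : ℤ) = 1) →
        ∀ T : ℝ, T₀ ≤ T → ∀ y : ℝ, 0 < y → y < T - 1/4 → T * y ≤ r₀ →
          max (T ^ 4 * (T * y / 2) ^ ((1:ℝ)/2)) (T ^ (-(1:ℝ)/6)) * (T * y / 2) ^ (-δ) ≤ 1 →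
          ∀ η : ℝ, 0 < η → η ≤ 1/4 →
            ‖(T : ℂ) * (∫ x in (0:ℝ)..1,
                lift a b (fT T h) ((x : ℂ) + (y : ℂ) * Complex.I) 0) -
              ((3 / (2 * Real.pi ^ 2) : ℝ) : ℂ) *
                (∫ θ in (0:ℝ)..(2 * Real.pi), ∫ x in (0:ℝ)..1, h x θ)‖ ≤
              C * (T ^ 4 / η ^ 4 *
                    ((T * y / 2) ^ ((1:ℝ)/2) * (Real.log (2 / (T * y))) ^ 2 +
                      (T * y / 2) ^ ((1:ℝ)/2)) +
                  (T * y / 2) ^ δ + T ^ (-(1:ℝ)/2) + η / T) := by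
  have hcont : Continuous (Function.uncurry h) := hsm.continuous
  have h2pi : 0 < 2 * Real.pi := by positivity
  obtain ⟨M, hM0, hM⟩ := exists_norm_le_of_periodic hcont one_pos h2pi
    (fun x θ => hper1 x θ) (fun x θ => hper2 x θ)
  replace hM : ∀ x θ, ‖h x θ‖ ≤ M := fun x θ => hM (x, θ)
  obtain ⟨L, hL0, hL⟩ := exists_lipschitz_of_periodic (hsm.of_le (by norm_cast))
    one_pos h2pi hper1 hper2
  set J := ∫ t : ℝ, (1 + ‖t‖ ^ 2) ^ (-(3 / 2 : ℝ) / 2) with hJ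
  have hJ0 : 0 ≤ J := integral_nonneg fun t => by positivity
  set D := (2 * L + 2 * M) * J with hD
  have hD0 : 0 ≤ D := by positivity
  refine ⟨2 * D + 1, by positivity, 2, le_rfl, 1 / 2, by norm_num, by norm_num, ?_⟩
  intro a b hab T hT y hy hyT hTy hmax η hη0 hη1
  have hT0 : 0 < T := by linarith
  have hu0 : 0 < T * y / 2 := by positivity
  have hδ : δ ≤ 1 / 4 := le_quarter_of_max_mul_le_one hT hu0 (by linarith) hmax
  have hbound : ‖(T : ℂ) * (∫ x in (0:ℝ)..1,
      lift a b (fT T h) ((x : ℂ) + (y : ℂ) * Complex.I) 0) -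
      ((3 / (2 * Real.pi ^ 2) : ℝ) : ℂ) *
      (∫ θ in (0:ℝ)..(2 * Real.pi), ∫ x in (0:ℝ)..1, h x θ)‖ ≤ D * (T * y) ^ ((1 : ℝ) / 4) := by
    have hTy0 : 0 < T * y := by positivity
    obtain ⟨R, hR⟩ : ∃ R, R = 1 / (T * y) := ⟨_, rfl⟩
    have hR0 : 0 < R := by rw [hR]; positivity
    have hRy : T * y * R = 1 := by rw [hR]; field_simp
    have hRyC : (T : ℂ) * y * R = 1 := by exact_mod_cast hRy
    have hunfold := fun c (hc : c ∈ Finset.Ioc 0 ⌊√R⌋₊) =>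
      integral_tsum_cuspKernel hcont hper1 hM R hy (Finset.mem_Ioc.1 hc).1
        (a := a c) (b := b c) (fun d hd => hab c d (Finset.mem_Ioc.1 hc).1 hd)
    simp_rw [lift_fT_eq_sum_cuspKernel h hab hT0 hy (by linarith : y < T), ← hR]
    rw [intervalIntegral.integral_finsetSum fun c hc => (hunfold c hc).1,
      Finset.sum_congr rfl fun c hc => (hunfold c hc).2, ← Finset.mul_sum]
    set S := ∑ c ∈ Finset.Ioc 0 ⌊√R⌋₊, ∑ j ∈ Finset.range c with j.Coprime c,
      ∫ t, cuspKernel h R y c ((j : ℝ) / c) t with hS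
    set Q := ∫ θ in (0 : ℝ)..(2 * Real.pi), ∫ x in (0 : ℝ)..1, h x θ with hQ
    have e1 : (T : ℂ) * (y * S) - ((3 / (2 * Real.pi ^ 2) : ℝ) : ℂ) * Q
        = ((T * y : ℝ) : ℂ) * (S - ((3 / (2 * Real.pi ^ 2) * R : ℝ) : ℂ) * Q) := by
      push_cast
      linear_combination (3 / (2 * (Real.pi : ℂ) ^ 2)) * Q * hRyC
    rw [e1, norm_mul, Complex.norm_real, Real.norm_eq_abs, abs_of_pos hTy0]
    calc _ ≤ T * y * ((2 * L + 2 * M) * R ^ ((3 : ℝ) / 4) * J) := by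
          gcongr
          exact norm_integral_cuspKernel_sub_le hcont hper1 hper2 hM hL hL0 hR0 y
      _ = D * (T * y) ^ ((1 : ℝ) / 4) := by
          have : T * y * R ^ ((3 : ℝ) / 4) = (T * y) ^ ((1 : ℝ) / 4) := by
            rw [hR, one_div, Real.inv_rpow hTy0.le, ← Real.rpow_neg hTy0.le]
            nth_rw 1 [← Real.rpow_one (T * y)]
            rw [← Real.rpow_add hTy0]
            norm_num
          rw [← this, hD]
          ring
  have hu : (T * y) ^ ((1 : ℝ) / 4) ≤ 2 * (T * y / 2) ^ δ := by
    have e1 : T * y = 2 * (T * y / 2) := by ring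
    calc (T * y) ^ ((1 : ℝ) / 4) = 2 ^ ((1 : ℝ) / 4) * (T * y / 2) ^ ((1 : ℝ) / 4) := by
          rw [← Real.mul_rpow zero_le_two hu0.le, ← e1]
      _ ≤ 2 ^ (1 : ℝ) * (T * y / 2) ^ δ := by
          gcongr ?_ * ?_
          · exact Real.rpow_le_rpow_of_exponent_le one_le_two (by norm_num)
          · exact Real.rpow_le_rpow_of_exponent_ge hu0 (by linarith) hδ
      _ = _ := by rw [Real.rpow_one]
  have hE1 : 0 ≤ T ^ 4 / η ^ 4 * ((T * y / 2) ^ ((1:ℝ)/2) * (Real.log (2 / (T * y))) ^ 2 +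
      (T * y / 2) ^ ((1:ℝ)/2)) := by positivity
  have hE2 : 0 ≤ T ^ (-(1:ℝ)/2) := by positivity
  have hE3 : 0 ≤ η / T := by positivity
  have hE4 : 0 ≤ (T * y / 2) ^ δ := by positivity
  calc _ ≤ D * (T * y) ^ ((1 : ℝ) / 4) := hbound
    _ ≤ D * (2 * (T * y / 2) ^ δ) := by gcongr
    _ ≤ (2 * D + 1) * (T * y / 2) ^ δ := by linarith
    _ ≤ _ := by
      refine mul_le_mul_of_nonneg_left ?_ (by positivity)
      linarith
end

section
/- For every integer n ≥ 0 and every m ∈ ℤ: | ∫_ℝ (χ⁺)⁽ⁿ⁾(x)·e(−mx) dx | ≤ 2·(β−α+ε)·(2/ε)ⁿ·M_ρ(n). -/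
open MeasureTheory

/-- `ℓ := ∫_{−1}^{1} exp(−1/(1−x²)) dx`. -/
noncomputable def ell : ℝ := ∫ x in (-1:ℝ)..1, Real.exp (-1 / (1 - x ^ 2))

/-- The standard mollifier `ρ`. -/
noncomputable def rho (x : ℝ) : ℝ :=
  if |x| < 1 then ell⁻¹ * Real.exp (-1 / (1 - x ^ 2)) else 0

/-- `ρ_ε(x) := ε⁻¹·ρ(x/ε)`. -/
noncomputable def rhoScaled (ε : ℝ) (x : ℝ) : ℝ := ε⁻¹ * rho (x / ε)

/-- `M_ρ(n) := sup_x |ρ⁽ⁿ⁾(x)|`. -/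
noncomputable def Mrho (n : ℕ) : ℝ := ⨆ x : ℝ, |iteratedDeriv n rho x|

/-- `χ⁺(x) := (χ_{[−r₊,r₊]} ∗ ρ_{ε/2})(x − (α+β)/2)` with `r₊ := (β−α+ε)/2`. -/
noncomputable def chiPlus (α β ε : ℝ) (x : ℝ) : ℝ :=
  ∫ t : ℝ, (if |x - (α + β) / 2 - t| ≤ (β - α + ε) / 2 then (1:ℝ) else 0) *
    rhoScaled (ε / 2) t

open scoped Convolution

theorem rho_eq_expNegInvGlue (x : ℝ) : rho x = ell⁻¹ * expNegInvGlue (1 - x ^ 2) := by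
  have key : |x| < 1 ↔ ¬ 1 - x ^ 2 ≤ 0 := by
    rw [← sq_lt_one_iff_abs_lt_one, not_le, sub_pos]
  by_cases h : |x| < 1
  · rw [rho, if_pos h, expNegInvGlue, if_neg (key.1 h), neg_div, one_div]
  · rw [rho, if_neg h, expNegInvGlue, if_pos (not_not.1 (mt key.2 h)), mul_zero]

theorem contDiff_rho (n : ℕ) : ContDiff ℝ n rho := by
  rw [funext rho_eq_expNegInvGlue]
  exact contDiff_const.mul
    ((expNegInvGlue.contDiff (n := n)).comp (contDiff_const.sub (contDiff_id.pow 2)))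

theorem tsupport_rho_subset : tsupport rho ⊆ Set.Icc (-1) 1 := by
  refine closure_minimal (fun x hx => ?_) isClosed_Icc
  by_contra h
  exact hx (if_neg fun hlt => h (abs_le.1 hlt.le))

theorem tsupport_iteratedDeriv_subset (f : ℝ → ℝ) (n : ℕ) :
    tsupport (iteratedDeriv n f) ⊆ tsupport f := by
  refine closure_minimal (fun x hx => ?_) isClosed_closure
  refine support_iteratedFDeriv_subset (𝕜 := ℝ) (f := f) n ?_
  rw [Function.mem_support] at hx ⊢
  rwa [← norm_ne_zero_iff, norm_iteratedFDeriv_eq_norm_iteratedDeriv, norm_ne_zero_iff]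

theorem HasCompactSupport.iteratedDeriv {f : ℝ → ℝ} (hf : HasCompactSupport f) (n : ℕ) :
    HasCompactSupport (iteratedDeriv n f) :=
  hf.of_isClosed_subset isClosed_closure (tsupport_iteratedDeriv_subset f n)

theorem hasCompactSupport_rho : HasCompactSupport rho :=
  isCompact_Icc.of_isClosed_subset isClosed_closure tsupport_rho_subset

theorem continuous_iteratedDeriv_rho (n : ℕ) : Continuous (iteratedDeriv n rho) :=
  (contDiff_rho n).continuous_iteratedDeriv n le_rfl

theorem abs_iteratedDeriv_rho_le (n : ℕ) (x : ℝ) : |iteratedDeriv n rho x| ≤ Mrho n := by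
  refine le_ciSup (f := fun x => |iteratedDeriv n rho x|) ?_ x
  obtain ⟨C, hC⟩ := (hasCompactSupport_rho.iteratedDeriv n).exists_bound_of_continuous
    (continuous_iteratedDeriv_rho n)
  exact ⟨C, by rintro _ ⟨y, rfl⟩; exact hC y⟩

theorem integral_abs_iteratedDeriv_rho_le (n : ℕ) :
    ∫ x, |iteratedDeriv n rho x| ≤ 2 * Mrho n := by
  have hsupp : ∫ x in Set.Icc (-1 : ℝ) 1, |iteratedDeriv n rho x| =
      ∫ x, |iteratedDeriv n rho x| := by
    refine setIntegral_eq_integral_of_forall_compl_eq_zero fun x hx => ?_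
    rw [image_eq_zero_of_notMem_tsupport fun h =>
      hx (tsupport_rho_subset (tsupport_iteratedDeriv_subset rho n h)), abs_zero]
  have hle := norm_setIntegral_le_of_norm_le_const (μ := volume) (s := Set.Icc (-1 : ℝ) 1)
    (f := fun x => |iteratedDeriv n rho x|) (C := Mrho n) measure_Icc_lt_top
    fun x _ => by simpa using abs_iteratedDeriv_rho_le n x
  rw [hsupp, Real.volume_real_Icc_of_le (by norm_num)] at hle
  linarith [Real.le_norm_self (∫ x, |iteratedDeriv n rho x|)]

theorem rhoScaled_eq (a : ℝ) : rhoScaled a = fun x => a⁻¹ * rho (a⁻¹ * x) := by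
  funext x
  rw [rhoScaled, div_eq_inv_mul]

theorem contDiff_rhoScaled (a : ℝ) (n : ℕ) : ContDiff ℝ n (rhoScaled a) := by
  rw [rhoScaled_eq]
  exact contDiff_const.mul ((contDiff_rho n).comp (contDiff_const.mul contDiff_id))

theorem hasCompactSupport_rhoScaled {a : ℝ} (ha : a ≠ 0) : HasCompactSupport (rhoScaled a) := by
  rw [rhoScaled_eq]
  exact (hasCompactSupport_rho.comp_smul (inv_ne_zero ha)).mul_left

theorem iteratedDeriv_rhoScaled (a : ℝ) (n : ℕ) (x : ℝ) :
    iteratedDeriv n (rhoScaled a) x = a⁻¹ * (a⁻¹ ^ n * iteratedDeriv n rho (a⁻¹ * x)) := by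
  rw [rhoScaled_eq, iteratedDeriv_const_mul_field, iteratedDeriv_comp_const_mul (contDiff_rho n)]

theorem integral_abs_iteratedDeriv_rhoScaled {a : ℝ} (ha : 0 < a) (n : ℕ) :
    ∫ x, |iteratedDeriv n (rhoScaled a) x| = a⁻¹ ^ n * ∫ x, |iteratedDeriv n rho x| := by
  have h (x : ℝ) : |iteratedDeriv n (rhoScaled a) x| =
      a⁻¹ * (a⁻¹ ^ n * |iteratedDeriv n rho (a⁻¹ * x)|) := by
    rw [iteratedDeriv_rhoScaled, abs_mul, abs_mul, abs_of_pos (inv_pos.2 ha),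
      abs_of_pos (pow_pos (inv_pos.2 ha) n)]
  simp_rw [h, integral_const_mul]
  rw [Measure.integral_comp_mul_left (fun y => |iteratedDeriv n rho y|), inv_inv, abs_of_pos ha,
    smul_eq_mul]
  field_simp

theorem iteratedDeriv_convolution_right {f g : ℝ → ℝ} (hf : LocallyIntegrable f)
    (hg : HasCompactSupport g) (hg' : ∀ n : ℕ, ContDiff ℝ n g) (n : ℕ) :
    iteratedDeriv n (f ⋆[ContinuousLinearMap.mul ℝ ℝ] g) =
      f ⋆[ContinuousLinearMap.mul ℝ ℝ] iteratedDeriv n g := by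
  induction n with
  | zero => simp only [iteratedDeriv_zero]
  | succ n ih =>
    funext x
    rw [iteratedDeriv_succ, ih, iteratedDeriv_succ]
    refine ((hg.iteratedDeriv n).hasDerivAt_convolution_right _ hf ?_ x).deriv
    rw [iteratedDeriv_eq_iterate]
    exact (hg' (1 + n)).iterate_deriv' 1 n

theorem integral_abs_convolution_le {f g : ℝ → ℝ} (hf : Integrable f) (hg : Integrable g) :
    ∫ x, |(f ⋆[ContinuousLinearMap.mul ℝ ℝ] g) x| ≤ (∫ x, |f x|) * ∫ x, |g x| := by
  rw [← ContinuousLinearMap.mul_apply' ℝ ℝ (∫ x, |f x|),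
    ← integral_convolution (ContinuousLinearMap.mul ℝ ℝ) hf.abs hg.abs]
  refine integral_mono (hf.integrable_convolution _ hg).abs
    (hf.abs.integrable_convolution _ hg.abs) fun x => ?_
  refine (abs_integral_le_integral_abs).trans_eq ?_
  simp only [convolution_def, ContinuousLinearMap.mul_apply', abs_mul]

theorem chiPlus_eq_convolution (α β ε x : ℝ) :
    chiPlus α β ε x = ((Set.Icc (-((β - α + ε) / 2)) ((β - α + ε) / 2)).indicator 1
      ⋆[ContinuousLinearMap.mul ℝ ℝ] rhoScaled (ε / 2)) (x - (α + β) / 2) := by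
  rw [convolution_mul_swap, chiPlus]
  simp only [Set.indicator_apply, Set.mem_Icc, ← abs_le, Pi.one_apply]

theorem norm_e_ofReal (w : ℝ) : ‖e w‖ = 1 := by
  rw [e, Complex.norm_exp]
  simp

/-- Fourier coefficient bound for the derivatives of `χ⁺`. -/
theorem stmt_12 (α β ε : ℝ) (hαβ : α < β) (hε0 : 0 < ε) (hε1 : ε < (β - α) / 2)
    (n : ℕ) (m : ℤ) :
    ‖∫ x : ℝ, Complex.ofReal (iteratedDeriv n (chiPlus α β ε) x) * e (-((m : ℂ) * (x : ℂ)))‖ ≤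
      2 * (β - α + ε) * (2 / ε) ^ n * Mrho n := by
  set r := (β - α + ε) / 2 with hr
  have hr0 : 0 < r := by linarith
  have hε2 : 0 < ε / 2 := half_pos hε0
  set χ : ℝ → ℝ := (Set.Icc (-r) r).indicator 1
  have hχ : Integrable χ :=
    (integrable_indicator_iff measurableSet_Icc).2 (integrableOn_const measure_Icc_lt_top.ne)
  have hχ1 : ∫ x, |χ x| = β - α + ε := by
    have habs (x : ℝ) : |χ x| = χ x := abs_of_nonneg (Set.indicator_nonneg (by simp) x)
    simp_rw [habs]
    rw [integral_indicator_one measurableSet_Icc, Real.volume_real_Icc_of_le (by linarith), hr]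
    ring
  set g := iteratedDeriv n (rhoScaled (ε / 2)) with hg_def
  have hsupp := hasCompactSupport_rhoScaled hε2.ne'
  have hg : Integrable g :=
    ((contDiff_rhoScaled _ n).continuous_iteratedDeriv n le_rfl).integrable_of_hasCompactSupport
      (hsupp.iteratedDeriv n)
  have hderiv (x : ℝ) : iteratedDeriv n (chiPlus α β ε) x =
      (χ ⋆[ContinuousLinearMap.mul ℝ ℝ] g) (x - (α + β) / 2) := by
    rw [funext (chiPlus_eq_convolution α β ε), iteratedDeriv_comp_sub_const,
      iteratedDeriv_convolution_right hχ.locallyIntegrable hsupp (contDiff_rhoScaled _)]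
  calc _ ≤ ∫ x : ℝ, ‖Complex.ofReal (iteratedDeriv n (chiPlus α β ε) x) *
          e (-((m : ℂ) * (x : ℂ)))‖ := norm_integral_le_integral_norm _
    _ = ∫ x : ℝ, |(χ ⋆[ContinuousLinearMap.mul ℝ ℝ] g) (x - (α + β) / 2)| := by
      refine integral_congr_ae (.of_forall fun x => ?_)
      have he : ‖e (-((m : ℂ) * (x : ℂ)))‖ = 1 := by
        simpa using norm_e_ofReal (-(m * x))
      simp only [norm_mul, he, mul_one, Complex.norm_real, Real.norm_eq_abs, hderiv]
    _ = ∫ x : ℝ, |(χ ⋆[ContinuousLinearMap.mul ℝ ℝ] g) x| :=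
      integral_sub_right_eq_self (fun x => |(χ ⋆[ContinuousLinearMap.mul ℝ ℝ] g) x|) _
    _ ≤ (∫ x, |χ x|) * ∫ x, |g x| := integral_abs_convolution_le hχ hg
    _ = (β - α + ε) * ((2 / ε) ^ n * ∫ x, |iteratedDeriv n rho x|) := by
      rw [hχ1, hg_def, integral_abs_iteratedDeriv_rhoScaled hε2, inv_div]
    _ ≤ (β - α + ε) * ((2 / ε) ^ n * (2 * Mrho n)) := by
      gcongr
      exact integral_abs_iteratedDeriv_rho_le n
    _ = _ := by ring
end

section
/- Let T > 0, let η satisfy 0 < η ≤ T/2, and let y > 0, c > 0. Set A := 1/(Tyc²) − 1 and A_η := 1/((T−η)yc²) − 1. If A > η/T, then 0 < A < A_η and √(A_η) − √A ≤ 4·√η/(T·√y·c). -/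
/-- Comparing the cutoff half-widths at heights `T` and `T − η`: the case `A > η/T`. -/
theorem stmt_18 (T η y c : ℝ) (hT : 0 < T) (hη : 0 < η) (hη' : η ≤ T / 2)
    (hy : 0 < y) (hc : 0 < c)
    (hA : η / T < 1 / (T * y * c ^ 2) - 1) :
    0 < 1 / (T * y * c ^ 2) - 1 ∧
      1 / (T * y * c ^ 2) - 1 < 1 / ((T - η) * y * c ^ 2) - 1 ∧
      Real.sqrt (1 / ((T - η) * y * c ^ 2) - 1) - Real.sqrt (1 / (T * y * c ^ 2) - 1) ≤
        4 * Real.sqrt η / (T * Real.sqrt y * c) := by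
  have hTη : 0 < T - η := by linarith
  have hA₀ : 0 < 1 / (T * y * c ^ 2) - 1 := (div_pos hη hT).trans hA
  refine ⟨hA₀, ?_, ?_⟩
  · gcongr
    linarith
  · have hR : 0 ≤ 4 * √η / (T * √y * c) := by positivity
    have hR_sq : (4 * √η / (T * √y * c)) ^ 2 = 16 * η / (T ^ 2 * y * c ^ 2) := by
      rw [div_pow, mul_pow, mul_pow, mul_pow, Real.sq_sqrt hη.le, Real.sq_sqrt hy.le]
      norm_num
    have hgap : 1 / ((T - η) * y * c ^ 2) ≤
        1 / (T * y * c ^ 2) + 16 * η / (T ^ 2 * y * c ^ 2) := by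
      have hsum : 1 / (T * y * c ^ 2) + 16 * η / (T ^ 2 * y * c ^ 2) =
          (T + 16 * η) / (T ^ 2 * y * c ^ 2) := by
        field_simp
      rw [hsum, div_le_div_iff₀ (by positivity) (by positivity)]
      have h : T ^ 2 ≤ (T + 16 * η) * (T - η) := by nlinarith
      have := mul_le_mul_of_nonneg_right h (by positivity : 0 ≤ y * c ^ 2)
      linarith
    rw [sub_le_iff_le_add, Real.sqrt_le_iff]
    refine ⟨by positivity, ?_⟩
    rw [add_sq, hR_sq, Real.sq_sqrt hA₀.le]
    have hcross := mul_nonneg hR (Real.sqrt_nonneg (1 / (T * y * c ^ 2) - 1))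
    linarith
end
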